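/- arXiv:0809.4047 — 7 statements merged into one kernel-verified Lean document; each statement's English description precedes it below -/
import Mathlib

section
/- Let N ∈ ℕ with N ≥ 3, let p ∈ (0,1), and let n ∈ ℕ satisfy N ≤ n ≤ (N − 1 − √(N−1))/p + 1. Then (n−1)^{N−1} e^{−(n−1)p} ≥ (n−1)^{(N−1)} (1−p)^{n−N}. -/
/-- The trapezoid bound for the concave function `log` on a unit interval. -/
lemma one_le_trapezoid_log {v : ℝ} (hv : 0 < v) :
    1 ≤ (v + 1 / 2) * (Real.log (v + 1) - Real.log v) := by
  have h := Real.le_log_one_add_of_nonneg (x := 1 / v) (by positivity)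
  have e : 1 + 1 / v = (v + 1) / v := by field_simp
  rw [e, Real.log_div (by positivity) hv.ne'] at h
  have e2 : 2 * (1 / v) / (1 / v + 2) = 1 / (v + 1 / 2) := by field_simp; ring
  rw [e2, div_le_iff₀ (by positivity)] at h
  linarith

/-- A Stirling-type upper bound for falling factorials. -/
lemma log_descFactorial_succ_le (m k : ℕ) (hk : k < m) :
    Real.log (m.descFactorial (k + 1)) ≤
      (m + 1 / 2) * Real.log m - (m - k - 1 / 2) * Real.log (m - k) - k := by
  induction k with
  | zero => simp; linarith
  | succ k ih =>
    have ih := ih (by omega)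
    have hv : (0 : ℝ) < m - (k + 1) := by
      have : ((k + 1 : ℕ) : ℝ) < m := by exact_mod_cast hk
      push_cast at this; linarith
    have hd : (m.descFactorial (k + 1) : ℝ) ≠ 0 := by
      have : 0 < m.descFactorial (k + 1) := Nat.descFactorial_pos.2 (by omega)
      positivity
    have ht := one_le_trapezoid_log hv
    rw [show (m : ℝ) - (k + 1) + 1 = m - k by ring] at ht
    rw [Nat.descFactorial_succ, Nat.cast_mul, Nat.cast_sub hk.le]
    push_cast
    rw [Real.log_mul hv.ne' hd]
    linarith

lemma log_le_half_sub_inv {t : ℝ} (ht : 1 ≤ t) : Real.log t ≤ (t - t⁻¹) / 2 := by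
  rw [← Real.sinh_log (by linarith)]
  exact Real.self_le_sinh_iff.2 (Real.log_nonneg ht)

lemma log_sub_log_le {x y : ℝ} (hx : 0 < x) (hy : 0 < y) :
    Real.log x - Real.log y ≤ (x - y) / y := by
  have h := Real.log_le_sub_one_of_pos (div_pos hx hy)
  rw [Real.log_div hx.ne' hy.ne'] at h
  rwa [sub_div, div_self hy.ne']

lemma log_concavity_bound {w s : ℝ} (hw : 0 < w) (hs : 1 ≤ s) :
    Real.log (w - 1 + s ^ 2) / 2 + (w - 1) * Real.log (w + s - 1) ≤
      (w - 1 / 2) * Real.log w + (s - 1) := by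
  have hb : 0 < w + s - 1 := by linarith
  have hm : 0 < w - 1 + s ^ 2 := by nlinarith
  have h1 := log_sub_log_le hm hb
  have h2 := log_sub_log_le hw hb
  have h3 := log_le_half_sub_inv (t := (w + s - 1) / w) (by rw [le_div_iff₀ hw]; linarith)
  rw [Real.log_div hb.ne' hw.ne'] at h3
  have h4 := mul_le_mul_of_nonneg_left h3 hw.le
  have key : w * (((w + s - 1) / w - ((w + s - 1) / w)⁻¹) / 2)
      + (w - (w + s - 1)) / (w + s - 1) / 2 + (w - 1 + s ^ 2 - (w + s - 1)) / (w + s - 1) / 2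
      = s - 1 := by
    field_simp
    ring
  linarith

/-- On `[0, q]` the function `p ↦ m p + (m - M) log (1 - p)` is bounded by its value at `q`
when `m - M ≤ m (1 - q)`. -/
lemma mul_add_log_one_sub_le {m M p q : ℝ} (hM : M ≤ m) (hpq : p ≤ q) (hq : q < 1)
    (h : m - M ≤ m * (1 - q)) :
    m * p + (m - M) * Real.log (1 - p) ≤ m * q + (m - M) * Real.log (1 - q) := by
  have hq' : 0 < 1 - q := by linarith
  have h1 := log_sub_log_le (show 0 < 1 - p by linarith) hq'
  have h2 := mul_le_mul_of_nonneg_left h1 (sub_nonneg.2 hM)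
  have h3 : (m - M) * ((1 - p - (1 - q)) / (1 - q)) ≤ m * (q - p) := by
    rw [← mul_div_assoc, div_le_iff₀ hq']
    nlinarith
  linarith

/-- Let `N ∈ ℕ`, `N ≥ 3`, `p ∈ (0,1)`, and let `n ∈ ℕ` satisfy
`N ≤ n ≤ (N − 1 − √(N−1))/p + 1`. Then
`(n−1)^(N−1) e^(−(n−1)p) ≥ (n−1)^{(N−1)} (1−p)^(n−N)`,
where `k^{(i)}` is the falling factorial (`Nat.descFactorial`). -/
theorem stmt_3 (N : ℕ) (hN : 3 ≤ N) (p : ℝ) (hp0 : 0 < p) (hp1 : p < 1)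
    (n : ℕ) (hn1 : N ≤ n)
    (hn2 : (n : ℝ) ≤ ((N : ℝ) - 1 - Real.sqrt ((N : ℝ) - 1)) / p + 1) :
    ((n : ℝ) - 1) ^ (N - 1) * Real.exp (-((n : ℝ) - 1) * p)
      ≥ ((n - 1).descFactorial (N - 1) : ℝ) * (1 - p) ^ (n - N) := by
  obtain ⟨k, rfl⟩ : ∃ k, N = k + 2 := ⟨N - 2, by omega⟩
  obtain ⟨m, rfl⟩ : ∃ m, n = m + 1 := ⟨n - 1, by omega⟩
  have hkm : k + 1 ≤ m := by omega
  have hkm' : (k : ℝ) + 1 ≤ m := by exact_mod_cast hkm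
  have hk0 : (0 : ℝ) ≤ k := k.cast_nonneg
  have hm : (0 : ℝ) < m := by linarith
  have hp : 0 < 1 - p := by linarith
  rw [show k + 2 - 1 = k + 1 by omega, show m + 1 - 1 = m by omega,
    show m + 1 - (k + 2) = m - (k + 1) by omega]
  push_cast at hn2 ⊢
  rw [show (k : ℝ) + 2 - 1 = k + 1 by ring] at hn2
  rw [show (m : ℝ) + 1 - 1 = m by ring]
  set s := Real.sqrt ((k : ℝ) + 1)
  have hs2 : s ^ 2 = k + 1 := Real.sq_sqrt (by linarith)
  have hs1 : 1 ≤ s := Real.one_le_sqrt.2 (by linarith)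
  have hpq : p ≤ (k + 1 - s) / m := by
    rw [le_div_iff₀ hm, mul_comm, ← le_div_iff₀ hp0]
    linarith
  have hq : 1 - (k + 1 - s) / m = (m - k - 1 + s) / m := by field_simp; ring
  have hmono := mul_add_log_one_sub_le hkm' hpq
    (by rw [div_lt_one hm]; linarith) (by rw [hq, mul_div_cancel₀ _ hm.ne']; linarith)
  rw [hq, mul_div_cancel₀ _ hm.ne', Real.log_div (by linarith) hm.ne'] at hmono
  have hdesc := log_descFactorial_succ_le m k hkm
  have hconc := log_concavity_bound (w := (m : ℝ) - k) (by linarith) hs1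
  rw [hs2, show (m : ℝ) - k - 1 + (k + 1) = m by ring,
    show (m : ℝ) - k + s - 1 = m - k - 1 + s by ring] at hconc
  have hd : (0 : ℝ) < m.descFactorial (k + 1) := by
    exact_mod_cast Nat.descFactorial_pos.2 hkm
  rw [ge_iff_le, ← Real.log_le_log_iff (by positivity) (by positivity),
    Real.log_mul hd.ne' (by positivity), Real.log_mul (by positivity) (Real.exp_ne_zero _),
    Real.log_pow, Real.log_pow, Real.log_exp, Nat.cast_sub hkm]
  push_cast
  linarith
end

section
/- Let N ∈ ℕ with N ≥ 3, let p ∈ (0,1), and let n ∈ ℕ satisfy N ≤ n and n ≤ (N − 1/2 − √(N − 1/2))/p + 1/2. Then (n − 1/2)^{N−1} e^{−(n−1/2)p} ≥ (n−1)^{(N−1)} (1−p)^{n−N}. -/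
open Finset intervalIntegral

/-- A lower bound for `log m - log (m - t)` from its second order Taylor formula, with the remainder
truncated at `x`. -/
lemma add_integral_max_le_log_sub_log {m x t : ℝ} (hx0 : 0 ≤ x) (hxm : x < m) (ht0 : 0 ≤ t)
    (htm : t < m) :
    t / m + ∫ a in (0 : ℝ)..x, max (t - a) 0 / (m - a) ^ 2 ≤ Real.log m - Real.log (m - t) := by
  have key : ∀ y, 0 ≤ y → y ≤ t →
      ∫ a in (0 : ℝ)..y, max (t - a) 0 / (m - a) ^ 2
        = (-Real.log (m - y) + (t - y) / (m - y)) - (-Real.log (m - 0) + (t - 0) / (m - 0)) := by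
    intro y hy0 hyt
    have hne : ∀ a ∈ Set.uIcc 0 y, m - a ≠ 0 := by
      intro a ha
      rw [Set.uIcc_of_le hy0] at ha
      linarith [ha.2]
    apply integral_eq_sub_of_hasDerivAt (f := fun a => -Real.log (m - a) + (t - a) / (m - a))
    · intro a ha
      have h0 := hne a ha
      rw [Set.uIcc_of_le hy0] at ha
      rw [max_eq_left (by linarith [ha.2])]
      have h1 : HasDerivAt (fun a : ℝ => m - a) (-1) a := by
        simpa using (hasDerivAt_id a).const_sub m
      have h2 : HasDerivAt (fun a : ℝ => t - a) (-1) a := by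
        simpa using (hasDerivAt_id a).const_sub t
      refine ((h1.log h0).neg.add (h2.div h1 h0)).congr_deriv ?_
      field_simp
      ring
    · apply ContinuousOn.intervalIntegrable
      exact ContinuousOn.div (by fun_prop) (by fun_prop) fun a ha => pow_ne_zero _ (hne a ha)
  rcases le_total x t with hxt | hxt
  · rw [key x hx0 hxt]
    have hpos : 0 < m - x := by linarith
    have h := Real.log_le_sub_one_of_pos (div_pos (by linarith : 0 < m - t) hpos)
    rw [Real.log_div (by linarith) hpos.ne'] at h
    have h' : (m - t) / (m - x) - 1 = -((t - x) / (m - x)) := by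
      field_simp
      ring
    simp only [sub_zero]
    linarith
  · have hi : ∀ b c : ℝ, b ∈ Set.Icc 0 x → c ∈ Set.Icc 0 x → IntervalIntegrable
        (fun a => max (t - a) 0 / (m - a) ^ 2) MeasureTheory.volume b c := by
      intro b c hb hc
      apply ContinuousOn.intervalIntegrable
      refine ContinuousOn.div (by fun_prop) (by fun_prop) fun a ha => pow_ne_zero _ ?_
      have := (Set.uIcc_subset_Icc hb hc ha).2
      linarith
    have hz : ∫ a in t..x, max (t - a) 0 / (m - a) ^ 2 = 0 := by
      rw [integral_congr (g := fun _ => (0 : ℝ))]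
      · simp
      · intro a ha
        rw [Set.uIcc_of_le hxt] at ha
        simp [max_eq_right (by linarith [ha.1] : t - a ≤ 0)]
    rw [← integral_add_adjacent_intervals (hi 0 t ⟨le_rfl, hx0⟩ ⟨ht0, hxt⟩)
      (hi t x ⟨ht0, hxt⟩ ⟨hx0, le_rfl⟩), hz, key t ht0 le_rfl]
    simp only [sub_zero, sub_self, zero_div]
    linarith

lemma half_sq_sub_sq_le_sum_max (a : ℝ) {i L : ℕ} (h : i ≤ L) :
    (((L : ℝ) - a) ^ 2 - ((i : ℝ) - a) ^ 2) / 2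
      ≤ ∑ j ∈ range L, max ((j : ℝ) + 1 / 2 - a) 0 := by
  induction L, h using Nat.le_induction with
  | base =>
    rw [sub_self, zero_div]
    exact sum_nonneg fun j _ => le_max_right _ _
  | succ k _ ih =>
    rw [sum_range_succ]
    have := le_max_left ((k : ℝ) + 1 / 2 - a) 0
    push_cast
    linarith

lemma half_sq_sub_le_sum_max {a : ℝ} (ha : 0 ≤ a) {L : ℕ} (haL : a ≤ L) :
    (((L : ℝ) + 1 / 2 - a) ^ 2 - ((L : ℝ) + 1 / 2)) / 2
      ≤ ∑ j ∈ range L, max ((j : ℝ) + 1 / 2 - a) 0 := by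
  have hfl : ⌊a⌋₊ ≤ L := by exact_mod_cast (Nat.floor_le ha).trans haL
  have h1 := Nat.floor_le ha
  have h2 := Nat.lt_floor_add_one a
  have h3 : (0 : ℝ) ≤ ⌊a⌋₊ := Nat.cast_nonneg _
  nlinarith [half_sq_sub_sq_le_sum_max a hfl,
    mul_nonneg (sub_nonneg.2 h1) (by linarith : 0 ≤ (⌊a⌋₊ : ℝ) + 1 - a)]

lemma integral_sq_sub_div_sq {M m c x : ℝ} (hx0 : 0 ≤ x) (hxm : x < m) :
    ∫ a in (0 : ℝ)..x, ((M - a) ^ 2 - c) / 2 / (m - a) ^ 2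
      = (x + 2 * (m - M) * (Real.log (m - x) - Real.log m)
          + ((m - M) ^ 2 - c) * (1 / (m - x) - 1 / m)) / 2 := by
  have hne : ∀ a ∈ Set.uIcc 0 x, m - a ≠ 0 := by
    intro a ha
    rw [Set.uIcc_of_le hx0] at ha
    linarith [ha.2]
  rw [integral_eq_sub_of_hasDerivAt (f := fun a =>
    (a + 2 * (m - M) * Real.log (m - a) + ((m - M) ^ 2 - c) * (m - a)⁻¹) / 2)]
  · simp only [sub_zero, one_div]
    ring
  · intro a ha
    have h0 := hne a ha
    have h1 : HasDerivAt (fun a : ℝ => m - a) (-1) a := by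
      simpa using (hasDerivAt_id a).const_sub m
    refine ((((hasDerivAt_id a).add ((h1.log h0).const_mul (2 * (m - M)))).add
      ((h1.inv h0).const_mul ((m - M) ^ 2 - c))).div_const 2).congr_deriv ?_
    field_simp
    ring
  · apply ContinuousOn.intervalIntegrable
    exact ContinuousOn.div (by fun_prop) (by fun_prop) fun a ha => pow_ne_zero _ (hne a ha)

lemma sum_range_add_half (L : ℕ) : ∑ j ∈ range L, ((j : ℝ) + 1 / 2) = (L : ℝ) ^ 2 / 2 := by
  induction L with
  | zero => simp
  | succ k ih =>
    rw [sum_range_succ, ih]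
    push_cast
    ring

lemma add_mul_log_le_sum_log {L : ℕ} (hL : 1 ≤ L) {m M s : ℝ} (hM : M = L + 1 / 2)
    (hmM : M ≤ m) (hs : 1 ≤ s) (hsM : s ^ 2 = M) :
    M - s + (m - M) * (Real.log (m - (M - s)) - Real.log m)
      ≤ ∑ j ∈ range L, (Real.log m - Real.log (m - ((j : ℝ) + 1 / 2))) := by
  have hL' : (1 : ℝ) ≤ L := by exact_mod_cast hL
  have hx0 : 0 ≤ M - s := by nlinarith
  have hxm : M - s < m := by linarith
  have hm : 0 < m := by linarith
  have hne : ∀ a ∈ Set.uIcc 0 (M - s), (m - a) ^ 2 ≠ 0 := by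
    intro a ha
    rw [Set.uIcc_of_le hx0] at ha
    exact pow_ne_zero _ (by linarith [ha.2])
  have hint : ∀ j ∈ range L, IntervalIntegrable
      (fun a => max ((j : ℝ) + 1 / 2 - a) 0 / (m - a) ^ 2) MeasureTheory.volume 0 (M - s) :=
    fun j _ => (ContinuousOn.div (by fun_prop) (by fun_prop) hne).intervalIntegrable
  have hmono : ∫ a in (0 : ℝ)..(M - s), ((M - a) ^ 2 - M) / 2 / (m - a) ^ 2
      ≤ ∫ a in (0 : ℝ)..(M - s), ∑ j ∈ range L, max ((j : ℝ) + 1 / 2 - a) 0 / (m - a) ^ 2 := by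
    apply integral_mono_on hx0
    · exact (ContinuousOn.div (by fun_prop) (by fun_prop) hne).intervalIntegrable
    · exact (continuousOn_finsetSum _ fun j _ =>
        ContinuousOn.div (by fun_prop) (by fun_prop) hne).intervalIntegrable
    · intro a ha
      rw [← sum_div]
      have := half_sq_sub_le_sum_max ha.1 (L := L) (by linarith [ha.2])
      rw [← hM] at this
      gcongr
  rw [integral_finsetSum hint, integral_sq_sub_div_sq hx0 hxm] at hmono
  have hsum := sum_le_sum fun j (hj : j ∈ range L) =>
    add_integral_max_le_log_sub_log hx0 hxm (t := (j : ℝ) + 1 / 2) (by positivity) (by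
      have : (j : ℝ) + 1 ≤ L := by exact_mod_cast mem_range.1 hj
      linarith)
  rw [sum_add_distrib, ← sum_div, sum_range_add_half] at hsum
  have halg : (L : ℝ) ^ 2 / 2 / m + ((m - M) ^ 2 - M) * (1 / (m - (M - s)) - 1 / m) / 2
      = (M - s) / 2 + 1 / (8 * m) := by
    have hd : m - (M - s) ≠ 0 := by linarith
    have h1 : ((m - M) ^ 2 - M) * (1 / (m - (M - s)) - 1 / m)
        = (m - M - s) - ((m - M) ^ 2 - M) / m := by
      have : (m - M) ^ 2 - M = (m - M - s) * (m - (M - s)) := by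
        rw [← hsM]
        ring
      rw [mul_sub, mul_one_div, mul_one_div, this, mul_div_cancel_right₀ _ hd]
    rw [h1, show (L : ℝ) = M - 1 / 2 by linarith]
    field_simp
    ring
  have : 0 < 1 / (8 * m) := by positivity
  linarith

/-- Let `N ∈ ℕ`, `N ≥ 3`, `p ∈ (0,1)`, and let `n ∈ ℕ` satisfy `N ≤ n` and
`n ≤ (N − 1/2 − √(N − 1/2))/p + 1/2`. Then
`(n − 1/2)^(N−1) e^(−(n−1/2)p) ≥ (n−1)^{(N−1)} (1−p)^(n−N)`,
where `k^{(i)}` is the falling factorial (`Nat.descFactorial`). -/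
theorem stmt_4 (N : ℕ) (hN : 3 ≤ N) (p : ℝ) (hp0 : 0 < p) (hp1 : p < 1)
    (n : ℕ) (hn1 : N ≤ n)
    (hn2 : (n : ℝ) ≤ ((N : ℝ) - 1 / 2 - Real.sqrt ((N : ℝ) - 1 / 2)) / p + 1 / 2) :
    ((n : ℝ) - 1 / 2) ^ (N - 1) * Real.exp (-((n : ℝ) - 1 / 2) * p)
      ≥ ((n - 1).descFactorial (N - 1) : ℝ) * (1 - p) ^ (n - N) := by
  have hN' : (3 : ℝ) ≤ N := by exact_mod_cast hN
  have hn' : (N : ℝ) ≤ n := by exact_mod_cast hn1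
  have hsM := Real.sq_sqrt (by linarith : (0 : ℝ) ≤ (N : ℝ) - 1 / 2)
  have hs : 1 ≤ Real.sqrt ((N : ℝ) - 1 / 2) := Real.one_le_sqrt.2 (by linarith)
  have hL : (((N - 1 : ℕ) : ℝ)) = N - 1 := by
    rw [Nat.cast_sub (by omega), Nat.cast_one]
  have hmp : ((n : ℝ) - 1 / 2) * p ≤ N - 1 / 2 - Real.sqrt ((N : ℝ) - 1 / 2) :=
    (le_div_iff₀ hp0).1 (by linarith)
  have hcore := add_mul_log_le_sum_log (L := N - 1) (by omega) (m := (n : ℝ) - 1 / 2)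
    (M := (N : ℝ) - 1 / 2) (by linarith) (by linarith) hs hsM
  generalize Real.sqrt ((N : ℝ) - 1 / 2) = s at *
  have hm : 0 < (n : ℝ) - 1 / 2 := by linarith
  have hp : 0 < 1 - p := by linarith
  have hprod : ((n - 1).descFactorial (N - 1) : ℝ)
      = ∏ j ∈ range (N - 1), ((n : ℝ) - 1 / 2 - ((j : ℝ) + 1 / 2)) := by
    rw [Nat.descFactorial_eq_prod_range, Nat.cast_prod]
    refine prod_congr rfl fun j hj => ?_
    have := mem_range.1 hj
    rw [Nat.cast_sub (by omega), Nat.cast_sub (by omega)]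
    push_cast
    ring
  have hpos : ∀ j ∈ range (N - 1), 0 < (n : ℝ) - 1 / 2 - ((j : ℝ) + 1 / 2) := by
    intro j hj
    have : (j : ℝ) + 1 ≤ (N - 1 : ℕ) := by exact_mod_cast mem_range.1 hj
    linarith
  have hprod_pos := prod_pos hpos
  rw [hprod, ge_iff_le, ← Real.log_le_log_iff (by positivity) (by positivity),
    Real.log_mul (by positivity) (by positivity), Real.log_mul (by positivity) (by positivity),
    Real.log_exp, Real.log_pow, Real.log_pow, Real.log_prod fun j hj => (hpos j hj).ne',
    Nat.cast_sub hn1]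
  rw [sum_sub_distrib, sum_const, card_range, nsmul_eq_mul] at hcore
  -- The exponent `m p + (m - M) log (1 - p)` is monotone in `p` on `[0, M / m]`.
  have hx : 0 < (n : ℝ) - 1 / 2 - (N - 1 / 2 - s) := by linarith
  have hlog := Real.log_le_sub_one_of_pos (div_pos (mul_pos hp hm) hx)
  rw [Real.log_div (by positivity) hx.ne', Real.log_mul hp.ne' hm.ne'] at hlog
  have hquot : ((n : ℝ) - N) *
      ((1 - p) * ((n : ℝ) - 1 / 2) / ((n : ℝ) - 1 / 2 - (N - 1 / 2 - s)) - 1)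
        ≤ (N - 1 / 2 - s) - ((n : ℝ) - 1 / 2) * p := by
    rw [div_sub_one hx.ne', mul_div_assoc', div_le_iff₀ hx]
    nlinarith
  have hmul := mul_le_mul_of_nonneg_left hlog (sub_nonneg.2 hn')
  linarith
end

section
/- Let M ≥ 4 be a real number, let j ≥ 2 be an integer, and let ν be a real number with 0 < ν ≤ M − √M. Then (M−1)^{j+2} + (j+1)ν^{j+2} − (j+2)Mν^{j+1} ≥ 0. -/
/-- Weighted AM-GM for `x ^ (k + 1)` and `k` copies of `y ^ (k + 1)`, in the range `y ≤ x`. -/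
lemma succ_mul_mul_pow_le_pow_add {x y : ℝ} (hy : 0 ≤ y) (hyx : y ≤ x) (k : ℕ) :
    ((k : ℝ) + 1) * x * y ^ k ≤ x ^ (k + 1) + k * y ^ (k + 1) := by
  induction k with
  | zero => simp
  | succ k ih =>
    have hpow : y ^ (k + 1) ≤ x ^ (k + 1) := pow_le_pow_left₀ hy hyx _
    have hprod := mul_nonneg (sub_nonneg.2 hyx) (sub_nonneg.2 hpow)
    have hmul := mul_le_mul_of_nonneg_left ih hy
    push_cast
    simp only [pow_succ] at *
    linarith

/-- The function `t ↦ (k + 1) * M * t ^ k - k * t ^ (k + 1)` is monotone on `[0, M]`. -/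
lemma succ_mul_pow_sub_mul_pow_succ_le {M x y : ℝ} (hy : 0 ≤ y) (hyx : y ≤ x) (hxM : x ≤ M)
    (k : ℕ) :
    ((k : ℝ) + 1) * M * y ^ k - k * y ^ (k + 1) ≤ (k + 1) * M * x ^ k - k * x ^ (k + 1) := by
  have hpow : y ^ k ≤ x ^ k := pow_le_pow_left₀ hy hyx _
  have hprod := mul_nonneg (mul_nonneg (by positivity : (0 : ℝ) ≤ k + 1) (sub_nonneg.2 hxM))
    (sub_nonneg.2 hpow)
  have hamgm := succ_mul_mul_pow_le_pow_add hy hyx k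
  simp only [pow_succ] at *
  linarith

lemma pow_mul_add_le_sub_one_mul_add_one_pow {s : ℝ} (hs : 2 ≤ s) {n : ℕ} (hn : 4 ≤ n) :
    s ^ n * (s + n - 1) ≤ (s - 1) * (s + 1) ^ n := by
  induction n, hn using Nat.le_induction with
  | base =>
    have h : 0 ≤ 2 * s ^ 3 - 2 * s ^ 2 - 3 * s - 1 := by
      nlinarith [mul_nonneg (sub_nonneg.2 hs) (sq_nonneg s), mul_nonneg (sub_nonneg.2 hs)
        (by linarith : 0 ≤ s)]
    push_cast
    linarith
  | succ n hn ih =>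
    have hn' : (4 : ℝ) ≤ n := by exact_mod_cast hn
    calc s ^ (n + 1) * (s + (n + 1 : ℕ) - 1) = s ^ n * (s * (s + n)) := by push_cast; ring
      _ ≤ s ^ n * ((s + n - 1) * (s + 1)) := by
        refine mul_le_mul_of_nonneg_left ?_ (by positivity)
        linarith
      _ = s ^ n * (s + n - 1) * (s + 1) := by ring
      _ ≤ (s - 1) * (s + 1) ^ n * (s + 1) := by gcongr
      _ = (s - 1) * (s + 1) ^ (n + 1) := by ring

/-- Let `M ≥ 4` be a real number, let `j ≥ 2` be an integer, and let `ν` be a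
real number with `0 < ν ≤ M − √M`. Then
`(M−1)^(j+2) + (j+1)·ν^(j+2) − (j+2)·M·ν^(j+1) ≥ 0`. -/
theorem stmt_9 (M : ℝ) (hM : 4 ≤ M) (j : ℕ) (hj : 2 ≤ j) (ν : ℝ)
    (hν0 : 0 < ν) (hν : ν ≤ M - Real.sqrt M) :
    (M - 1) ^ (j + 2) + (j + 1 : ℝ) * ν ^ (j + 2) - (j + 2 : ℝ) * M * ν ^ (j + 1) ≥ 0 := by
  obtain ⟨s, hs, rfl⟩ : ∃ s : ℝ, 2 ≤ s ∧ M = s ^ 2 :=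
    ⟨√M, Real.le_sqrt_of_sq_le (by linarith), (Real.sq_sqrt (by linarith)).symm⟩
  rw [Real.sqrt_sq (by linarith)] at hν
  have hmono := succ_mul_pow_sub_mul_pow_succ_le hν0.le hν
    (by linarith : s ^ 2 - s ≤ s ^ 2) (j + 1)
  have hend := mul_le_mul_of_nonneg_left
    (pow_mul_add_le_sub_one_mul_add_one_pow hs (by omega : 4 ≤ j + 2))
    (pow_nonneg (by linarith : 0 ≤ s - 1) (j + 1))
  have hleft : (s - 1) ^ (j + 1) * ((s - 1) * (s + 1) ^ (j + 2)) = (s ^ 2 - 1) ^ (j + 2) := by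
    rw [show s ^ 2 - 1 = (s - 1) * (s + 1) by ring, mul_pow]
    ring
  have hright : (s - 1) ^ (j + 1) * (s ^ (j + 2) * (s + (j + 2 : ℕ) - 1)) =
      ((j + 1 : ℕ) + 1) * s ^ 2 * (s ^ 2 - s) ^ (j + 1)
        - (j + 1 : ℕ) * (s ^ 2 - s) ^ (j + 1 + 1) := by
    rw [show s ^ 2 - s = s * (s - 1) by ring, mul_pow, mul_pow]
    push_cast
    ring
  rw [hleft, hright] at hend
  push_cast at hmono hend
  linarith
end

section
/- Let j ≥ 2 be an integer and let ν be a real number with 0 < ν ≤ 3 − √3. Then (j+2)(1 + 2^{j+1}) + (j+1)ν^{j+2} − 3(j+2)ν^{j+1} > 0. -/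
/-- For `0 ≤ x ≤ 4/3` and `n ≥ 3`, three copies of `x ^ n` fit below `2 ^ n`. -/
theorem three_mul_pow_le_two_pow {x : ℝ} (hx0 : 0 ≤ x) (hx : x ≤ 4 / 3) {n : ℕ} (hn : 3 ≤ n) :
    3 * x ^ n ≤ 2 ^ n := by
  induction n, hn using Nat.le_induction with
  | base =>
    have h : x ^ 3 ≤ (4 / 3) ^ 3 := pow_le_pow_left₀ hx0 hx 3
    norm_num at h ⊢
    linarith
  | succ n _ ih =>
    calc 3 * x ^ (n + 1) = 3 * x ^ n * x := by ring
      _ ≤ 2 ^ n * 2 := mul_le_mul ih (by linarith) hx0 (by positivity)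
      _ = 2 ^ (n + 1) := (pow_succ _ _).symm

/-- Let `j ≥ 2` be an integer and `ν` real with `0 < ν ≤ 3 − √3`. Then
`(j+2)(1 + 2^(j+1)) + (j+1)ν^(j+2) − 3(j+2)ν^(j+1) > 0`. -/
theorem stmt_12 (j : ℕ) (hj : 2 ≤ j) (ν : ℝ) (hν0 : 0 < ν) (hν : ν ≤ 3 - Real.sqrt 3) :
    (j + 2 : ℝ) * (1 + 2 ^ (j + 1)) + (j + 1 : ℝ) * ν ^ (j + 2)
      - 3 * (j + 2 : ℝ) * ν ^ (j + 1) > 0 := by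
  have hsqrt : (5 / 3 : ℝ) ≤ Real.sqrt 3 := Real.le_sqrt_of_sq_le (by norm_num)
  have hpow : 3 * ν ^ (j + 1) ≤ 2 ^ (j + 1) :=
    three_mul_pow_le_two_pow hν0.le (by linarith) (by omega)
  have hmul : 0 < (j + 2 : ℝ) * (1 + 2 ^ (j + 1) - 3 * ν ^ (j + 1)) :=
    mul_pos (by positivity) (by linarith)
  have hlast : 0 < (j + 1 : ℝ) * ν ^ (j + 2) := by positivity
  linarith
end

section
/- Let M ≥ 2 be a real number and let ν be a real number with 0 < ν ≤ M − √M. Then 4ν³ − 6Mν² + 2(M−1)³ + 3(M−1)² + (M−1) > 0. -/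
/-- The cubic `4x³ − 6Mx²` is antitone on `[0, M]`. -/
lemma cubic_le_cubic_of_le {M x y : ℝ} (hx : 0 ≤ x) (hxy : x ≤ y) (hy : y ≤ M) :
    4 * y ^ 3 - 6 * M * y ^ 2 ≤ 4 * x ^ 3 - 6 * M * x ^ 2 := by
  have hx' : 0 ≤ x * (6 * M - 4 * x - 2 * y) := mul_nonneg hx (by linarith)
  have hy' : 0 ≤ y * (6 * M - 4 * y - 2 * x) := mul_nonneg (hx.trans hxy) (by linarith)
  linear_combination mul_nonneg (sub_nonneg.2 hxy) (add_nonneg hx' hy')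

/-- Let `M ≥ 2` be real and `ν` real with `0 < ν ≤ M − √M`. Then
`4ν³ − 6Mν² + 2(M−1)³ + 3(M−1)² + (M−1) > 0`. -/
theorem stmt_14 (M : ℝ) (hM : 2 ≤ M) (ν : ℝ) (hν0 : 0 < ν) (hν : ν ≤ M - Real.sqrt M) :
    4 * ν ^ 3 - 6 * M * ν ^ 2 + 2 * (M - 1) ^ 3 + 3 * (M - 1) ^ 2 + (M - 1) > 0 := by
  obtain ⟨s, hs⟩ : ∃ s, s = Real.sqrt M := ⟨_, rfl⟩
  have hs1 : 1 < s := hs ▸ Real.lt_sqrt_of_sq_lt (by linarith)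
  have hsM : M = s ^ 2 := by rw [hs, Real.sq_sqrt (by linarith)]
  rw [← hs] at hν
  have hle := cubic_le_cubic_of_le (M := M) hν0.le hν (by linarith)
  have hpos : 0 < s ^ 2 * ((3 * s - 1) * (s - 1)) :=
    mul_pos (by positivity) (mul_pos (by linarith) (by linarith))
  subst hsM
  linear_combination hle + hpos
end

section
/- Let j ≥ 2 be an integer and let ν' be a real number with 0 < ν' ≤ 7/2 − √(7/2). Then (j+2)((1/2)^{j+1} + (3/2)^{j+1} + (5/2)^{j+1}) + (j+1)ν'^{j+2} − (7/2)(j+2)ν'^{j+1} > 0. -/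
/-- Let `j ≥ 2` be an integer and `ν'` real with `0 < ν' ≤ 7/2 − √(7/2)`. Then
`(j+2)((1/2)^(j+1) + (3/2)^(j+1) + (5/2)^(j+1)) + (j+1)ν'^(j+2) − (7/2)(j+2)ν'^(j+1) > 0`. -/
theorem stmt_17 (j : ℕ) (hj : 2 ≤ j) (ν' : ℝ) (hν0 : 0 < ν')
    (hν : ν' ≤ 7 / 2 - Real.sqrt (7 / 2)) :
    (j + 2 : ℝ) * ((1 / 2 : ℝ) ^ (j + 1) + (3 / 2 : ℝ) ^ (j + 1) + (5 / 2 : ℝ) ^ (j + 1))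
      + (j + 1 : ℝ) * ν' ^ (j + 2) - 7 / 2 * (j + 2 : ℝ) * ν' ^ (j + 1) > 0 := by
  have hsqrt : (186 / 100 : ℝ) ≤ Real.sqrt (7 / 2) := Real.le_sqrt_of_sq_le (by norm_num)
  have hν_le : ν' ≤ 164 / 100 := by linarith
  have hdom : 7 / 2 * ν' ^ (j + 1) ≤ (5 / 2 : ℝ) ^ (j + 1) := by
    obtain ⟨k, rfl⟩ := Nat.exists_eq_add_of_le' hj
    calc 7 / 2 * ν' ^ (k + 2 + 1) = ν' ^ k * (7 / 2 * ν' ^ 3) := by ring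
      _ ≤ (5 / 2) ^ k * (7 / 2 * (164 / 100) ^ 3) := by
        gcongr
        linarith
      _ ≤ (5 / 2) ^ k * (5 / 2) ^ 3 := by
        gcongr
        norm_num
      _ = (5 / 2) ^ (k + 2 + 1) := by ring
  have hdom_mul := mul_le_mul_of_nonneg_left hdom (by positivity : (0 : ℝ) ≤ j + 2)
  have hrest : 0 < (j + 2 : ℝ) * ((1 / 2 : ℝ) ^ (j + 1) + (3 / 2 : ℝ) ^ (j + 1))
      + (j + 1 : ℝ) * ν' ^ (j + 2) := by positivity
  linarith
end

section
/- Let j ≥ 2 be an integer and let ν' be a real number with 0 < ν' ≤ 5/2 − √(5/2). Then (j+2)((1/2)^{j+1} + (3/2)^{j+1}) + (j+1)ν'^{j+2} − (5/2)(j+2)ν'^{j+1} > 0. -/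
/-- Let `j ≥ 2` be an integer and `ν'` real with `0 < ν' ≤ 5/2 − √(5/2)`. Then
`(j+2)((1/2)^(j+1) + (3/2)^(j+1)) + (j+1)ν'^(j+2) − (5/2)(j+2)ν'^(j+1) > 0`. -/
theorem stmt_18 (j : ℕ) (hj : 2 ≤ j) (ν' : ℝ) (hν0 : 0 < ν')
    (hν : ν' ≤ 5 / 2 - Real.sqrt (5 / 2)) :
    (j + 2 : ℝ) * ((1 / 2 : ℝ) ^ (j + 1) + (3 / 2 : ℝ) ^ (j + 1))
      + (j + 1 : ℝ) * ν' ^ (j + 2) - 5 / 2 * (j + 2 : ℝ) * ν' ^ (j + 1) > 0 := by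
  have hsqrt : (3 / 2 : ℝ) ≤ Real.sqrt (5 / 2) := Real.le_sqrt_of_sq_le (by norm_num)
  have hν_pow : ν' ^ (j + 1) ≤ 1 := pow_le_one₀ hν0.le (by linarith)
  have hthree : (3 / 2 : ℝ) ^ 3 ≤ (3 / 2 : ℝ) ^ (j + 1) :=
    pow_le_pow_right₀ (by norm_num) (by omega)
  have hhalf : (0 : ℝ) < (1 / 2) ^ (j + 1) := by positivity
  have hlast : 0 < (j + 1 : ℝ) * ν' ^ (j + 2) := by positivity
  have hmain : 0 < (j + 2 : ℝ) *
      ((1 / 2 : ℝ) ^ (j + 1) + (3 / 2 : ℝ) ^ (j + 1) - 5 / 2 * ν' ^ (j + 1)) :=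
    mul_pos (by positivity) (by linarith)
  linarith
end
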